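/- arXiv:math/0605398 — 3 statements merged into one kernel-verified Lean document; each statement's English description precedes it below -/
import Mathlib

section
/- Let T be a tree on 2n+1 vertices with a semigraceful labeling ℓ, regarded via ℓ as a spanning tree of the complete graph on the vertex set ZMod(2n+1) (identifying label i with the residue i mod 2n+1). For k ∈ ZMod(2n+1), let T+k denote the rotated copy of T whose edges are {u+k, v+k} for edges {u,v} of T. Then for every pair {a,b} of distinct elements of ZMod(2n+1), the number of k ∈ ZMod(2n+1) for which {a,b} is an edge of T+k is exactly 2. Equivalently, the 2n+1 cyclic rotations of T decompose the complete multigraph K_{2n+1}^{(2)} of order 2n+1 with edge multiplicity 2. -/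
/-- Cyclic distance `dc_n(s,t)`. -/
def dc (n s t : ℕ) : ℕ := min (Nat.dist s t) (n - Nat.dist s t)

/-- `dc` as a function on unordered pairs. -/
def dcSym2 (n : ℕ) : Sym2 ℕ → ℕ :=
  Sym2.lift ⟨dc n, fun s t => by simp [dc, Nat.dist_comm]⟩

/-- Multiset of induced edge labels `dc_n(lab u, lab v)` over the edges of `T`. -/
noncomputable def edgeLabels {V : Type*} [Finite V] (n : ℕ) (T : SimpleGraph V)
    (lab : V → ℕ) : Multiset ℕ :=
  (T.edgeSet.toFinite.toFinset).val.map (fun e => dcSym2 n (Sym2.map lab e))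

/-- A graph on `2n+1` vertices is semigraceful if some bijective labeling by `1,…,2n+1`
induces the multiset `{1,1,2,2,…,n,n}` of cyclic-distance edge labels. -/
def IsSemigraceful {V : Type*} [Finite V] (n : ℕ) (T : SimpleGraph V) : Prop :=
  ∃ ℓ : V ≃ Fin (2 * n + 1),
    edgeLabels (2 * n + 1) T (fun v => (ℓ v : ℕ) + 1) =
      Multiset.Icc 1 n + Multiset.Icc 1 n

/-- A graph on `p` vertices is graceful if some bijective labeling by `0,…,p-1` makes the
induced absolute-difference edge labels pairwise distinct. -/
def IsGraceful {V : Type*} [Finite V] (p : ℕ) (T : SimpleGraph V) : Prop :=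
  ∃ ℓ : V ≃ Fin p,
    Set.InjOn
      (Sym2.lift ⟨fun u v => Nat.dist (ℓ u : ℕ) (ℓ v : ℕ), fun u v => Nat.dist_comm _ _⟩)
      T.edgeSet

/-- Number of members of a multiset satisfying a (not necessarily decidable) predicate. -/
noncomputable def countP' {α : Type*} (p : α → Prop) (M : Multiset α) : ℕ :=
  @Multiset.countP α p (Classical.decPred p) M

/-- The number of isomorphism classes of trees on `m` vertices. -/
noncomputable def tau (m : ℕ) : ℕ :=
  Nat.card (Quot fun G H : { T : SimpleGraph (Fin m) // T.IsTree } => Nonempty (G.1 ≃g H.1))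

/-- The cyclic distance of two residues is the least absolute value of their difference. -/
theorem dc_val_add_one (m : ℕ) [NeZero m] (x y : ZMod m) :
    dc m (x.val + 1) (y.val + 1) = (x - y).valMinAbs.natAbs := by
  wlog h : y.val ≤ x.val generalizing x y
  · rw [← neg_sub y x, ZMod.natAbs_valMinAbs_neg, ← this y x (by omega), dc, dc, Nat.dist_comm]
  · rw [ZMod.valMinAbs_natAbs_eq_min, ZMod.val_sub h, dc,
      Nat.dist_eq_sub_of_le_right (by omega)]
    simp

theorem dcSym2_map_val_add_one (m : ℕ) [NeZero m] (x y : ZMod m) :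
    dcSym2 m (Sym2.map (fun v : ZMod m => v.val + 1) s(x, y)) = (x - y).valMinAbs.natAbs :=
  dc_val_add_one m x y

/-- In `ZMod (2n+1)`, only `0` equals its own negative. -/
theorem ZMod.eq_of_sub_eq_sub_swap (n : ℕ) {a b : ZMod (2 * n + 1)} (h : a - b = b - a) :
    a = b := by
  have := (ZMod.neg_eq_self_iff (a - b)).1 (by rw [neg_sub, h])
  rcases this with h | h
  · exact sub_eq_zero.1 h
  · omega

/-- The rotations of `T` containing `{a, b}` correspond to the edges of `T` having the same
cyclic distance as `{a, b}`. -/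
theorem card_rotations_eq_count_edgeLabels (n : ℕ) (T : SimpleGraph (ZMod (2 * n + 1)))
    {a b : ZMod (2 * n + 1)} (hab : a ≠ b) :
    Nat.card {k : ZMod (2 * n + 1) // T.Adj (a - k) (b - k)} =
      (edgeLabels (2 * n + 1) T (fun v => v.val + 1)).count (a - b).valMinAbs.natAbs := by
  classical
  rw [edgeLabels, Multiset.count_map, Nat.card_eq_fintype_card, Fintype.card_subtype,
    ← Finset.filter_val, Finset.card_val]
  refine Finset.card_bij (fun k _ => s(a - k, b - k)) ?_ ?_ ?_
  · intro k hk
    simp only [Finset.mem_filter, Finset.mem_univ, true_and] at hk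
    simp only [Finset.mem_filter, Set.Finite.mem_toFinset, SimpleGraph.mem_edgeSet,
      dcSym2_map_val_add_one]
    exact ⟨hk, by congr 2; ring⟩
  · intro k _ l _ h
    rcases Sym2.eq_iff.1 h with ⟨h, -⟩ | ⟨h₁, h₂⟩
    · exact sub_right_injective h
    · exact absurd (ZMod.eq_of_sub_eq_sub_swap n (by linear_combination h₁ - h₂)) hab
  · intro e
    induction e with | _ u v
    simp only [Finset.mem_filter, Set.Finite.mem_toFinset, SimpleGraph.mem_edgeSet,
      dcSym2_map_val_add_one, Finset.mem_univ, true_and,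
      ZMod.natAbs_valMinAbs_eq_natAbs_valMinAbs]
    rintro ⟨huv, h | h⟩
    · have hb : b - (a - u) = v := by linear_combination -h
      exact ⟨a - u, by simpa [hb] using huv, by simp [hb]⟩
    · have hb : b - (a - v) = u := by linear_combination -h
      exact ⟨a - v, by simpa [hb] using huv.symm, by simp [hb, Sym2.eq_swap]⟩

/-- the 2n+1 cyclic rotations of a semigracefully embedded tree on
`ZMod (2n+1)` cover every pair of distinct vertices exactly twice, i.e. they decompose
`K_{2n+1}^{(2)}`. -/
theorem rotations_of_semigraceful_tree_decompose (n : ℕ)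
    (T : SimpleGraph (ZMod (2 * n + 1))) (hT : T.IsTree)
    (hsg : edgeLabels (2 * n + 1) T (fun v => v.val + 1) =
      Multiset.Icc 1 n + Multiset.Icc 1 n) :
    ∀ a b : ZMod (2 * n + 1), a ≠ b →
      Nat.card {k : ZMod (2 * n + 1) // T.Adj (a - k) (b - k)} = 2 := by
  intro a b hab
  have hpos : 1 ≤ (a - b).valMinAbs.natAbs := by
    rw [Nat.one_le_iff_ne_zero, Int.natAbs_ne_zero, Ne, ZMod.valMinAbs_eq_zero]
    exact sub_ne_zero.2 hab
  have hle : (a - b).valMinAbs.natAbs ≤ n := by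
    have := ZMod.natAbs_valMinAbs_le (a - b)
    omega
  have hmem : (a - b).valMinAbs.natAbs ∈ Multiset.Icc 1 n := Multiset.mem_Icc.2 ⟨hpos, hle⟩
  rw [card_rotations_eq_count_edgeLabels n T hab, hsg, Multiset.count_add,
    Multiset.count_eq_one_of_mem Multiset.nodup_Icc hmem]
end

section
/- Fix n ≥ 1 and suppose that every tree of order 2n+1 is semigraceful. Let τ(2n+1) denote the number of isomorphism classes of trees on 2n+1 vertices. Then K_{2n+1}^{(2τ(2n+1))} has a decomposition into 2n+1 copies of the family of all trees of order 2n+1: there exists a multiset M of spanning trees of the complete graph on 2n+1 vertices such that every isomorphism class of trees on 2n+1 vertices is represented by exactly 2n+1 members of M (counted with multiplicity), and every pair of distinct vertices is an edge of exactly 2τ(2n+1) members of M (counted with multiplicity). -/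
/-- The cyclic distance on `Fin N` depends only on the difference. -/
theorem dc_val_eq {N : ℕ} [NeZero N] (x y : Fin N) :
    dc N (x : ℕ) (y : ℕ) = min ((x - y : Fin N) : ℕ) (N - ((x - y : Fin N) : ℕ)) := by
  have hx := x.isLt
  have hy := y.isLt
  unfold dc Nat.dist
  rcases le_or_gt y x with h | h
  · rw [Fin.coe_sub_iff_le.2 h]
    rw [Fin.le_def] at h
    omega
  · rw [Fin.coe_sub_iff_lt.2 h]
    rw [Fin.lt_def] at h
    omega

theorem dc_succ_succ (N x y : ℕ) : dc N (x + 1) (y + 1) = dc N x y := by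
  simp [dc, Nat.dist_add_add_right]

theorem dc_add_right {N : ℕ} [NeZero N] (x y c : Fin N) :
    dc N ((x + c : Fin N) : ℕ) ((y + c : Fin N) : ℕ) = dc N (x : ℕ) (y : ℕ) := by
  rw [dc_val_eq, dc_val_eq, add_sub_add_right_eq_sub]

/-- Pairs at the same cyclic distance have the same difference up to sign. -/
theorem sub_eq_or_sub_eq_of_dc_eq {N : ℕ} [NeZero N] {x y a b : Fin N} (hab : a ≠ b)
    (h : dc N (x : ℕ) (y : ℕ) = dc N (a : ℕ) (b : ℕ)) : x - y = a - b ∨ x - y = b - a := by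
  have hb : ((b - a : Fin N) : ℕ) = N - ((a - b : Fin N) : ℕ) := by
    have ha := a.isLt
    have hb := b.isLt
    rcases lt_or_gt_of_ne hab with hlt | hlt
    · rw [Fin.coe_sub_iff_le.2 hlt.le, Fin.coe_sub_iff_lt.2 hlt]
      rw [Fin.lt_def] at hlt
      omega
    · rw [Fin.coe_sub_iff_le.2 hlt.le, Fin.coe_sub_iff_lt.2 hlt]
      rw [Fin.lt_def] at hlt
      omega
  rw [dc_val_eq, dc_val_eq] at h
  rw [Fin.ext_iff, Fin.ext_iff, hb]
  have h₁ := (x - y).isLt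
  have h₂ := (a - b).isLt
  omega

theorem dc_mem_Icc {n : ℕ} {a b : Fin (2 * n + 1)} (hab : a ≠ b) :
    dc (2 * n + 1) (a : ℕ) (b : ℕ) ∈ Finset.Icc 1 n := by
  have h : (a : ℕ) ≠ b := Fin.val_injective.ne hab
  have ha := a.isLt
  have hb := b.isLt
  rw [Finset.mem_Icc]
  unfold dc Nat.dist
  omega

theorem eq_of_sub_eq_sub_rev {n : ℕ} {a b : Fin (2 * n + 1)} (h : a - b = b - a) : a = b := by
  by_contra hab
  have ha := a.isLt
  have hb := b.isLt
  rw [Fin.ext_iff] at h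
  rcases lt_or_gt_of_ne hab with hlt | hlt
  · rw [Fin.coe_sub_iff_le.2 hlt.le, Fin.coe_sub_iff_lt.2 hlt] at h
    rw [Fin.lt_def] at hlt
    omega
  · rw [Fin.coe_sub_iff_le.2 hlt.le, Fin.coe_sub_iff_lt.2 hlt] at h
    rw [Fin.lt_def] at hlt
    omega

/-- The vertex permutation carrying the rotation by `c` of the labeling `ℓ`. -/
def rotateEquiv {V : Type*} {N : ℕ} [NeZero N] (ℓ : V ≃ Fin N) (c : Fin N) : Fin N ≃ V :=
  (Equiv.addRight c).trans ℓ.symm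

open Classical in
/-- Exactly two rotations of a semigraceful labeling cover a given pair. -/
theorem card_rotations_adj {V : Type*} [Finite V] {n : ℕ} {T : SimpleGraph V}
    {ℓ : V ≃ Fin (2 * n + 1)}
    (hℓ : edgeLabels (2 * n + 1) T (fun v => (ℓ v : ℕ) + 1) =
      Multiset.Icc 1 n + Multiset.Icc 1 n)
    {a b : Fin (2 * n + 1)} (hab : a ≠ b) :
    (Finset.univ.filter fun c => (T.comap (rotateEquiv ℓ c)).Adj a b).card = 2 := by
  have hcount := congrArg (Multiset.count (dc (2 * n + 1) (a : ℕ) (b : ℕ))) hℓ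
  have hIcc : Multiset.count (dc (2 * n + 1) (a : ℕ) (b : ℕ)) (Multiset.Icc 1 n) = 1 :=
    Multiset.count_eq_one_of_mem (Finset.Icc 1 n).nodup (dc_mem_Icc hab)
  rw [Multiset.count_add, hIcc, edgeLabels, Multiset.count_map, ← Finset.filter_val,
    Finset.card_val] at hcount
  refine Eq.trans ?_ hcount
  refine Finset.card_bij
    (fun c _ => s(rotateEquiv ℓ c a, rotateEquiv ℓ c b)) ?_ ?_ ?_
  · intro c hc
    simp only [Finset.mem_filter, Finset.mem_univ, true_and, SimpleGraph.comap_adj] at hc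
    rw [Finset.mem_filter, Set.Finite.mem_toFinset]
    exact ⟨hc, by simp [dcSym2, dc_succ_succ, rotateEquiv, dc_add_right]⟩
  · intro c _ d _ h
    rcases Sym2.eq_iff.1 h with ⟨h, -⟩ | ⟨h₁, h₂⟩
    · simpa [rotateEquiv] using h
    · simp only [rotateEquiv, Equiv.trans_apply, Equiv.coe_addRight,
        EmbeddingLike.apply_eq_iff_eq] at h₁ h₂
      refine absurd (eq_of_sub_eq_sub_rev ?_) hab
      rw [← add_sub_add_right_eq_sub a b c, h₁, h₂, add_sub_add_right_eq_sub]
  · intro e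
    induction e with
    | h u v =>
      intro he
      rw [Finset.mem_filter, Set.Finite.mem_toFinset, SimpleGraph.mem_edgeSet] at he
      simp only [dcSym2, Sym2.map_mk, Sym2.lift_mk, dc_succ_succ] at he
      obtain ⟨hadj, hdc⟩ := he
      rcases sub_eq_or_sub_eq_of_dc_eq hab hdc.symm with h | h
      · have hu : rotateEquiv ℓ (ℓ u - a) a = u := by simp [rotateEquiv]
        have hv : rotateEquiv ℓ (ℓ u - a) b = v := by
          have : b + (ℓ u - a) = ℓ v := by
            rw [← sub_sub_cancel (ℓ u) (ℓ v), h]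
            abel
          simp [rotateEquiv, this]
        exact ⟨ℓ u - a, by simpa [hu, hv] using hadj, by rw [hu, hv]⟩
      · have hu : rotateEquiv ℓ (ℓ u - b) b = u := by simp [rotateEquiv]
        have hv : rotateEquiv ℓ (ℓ u - b) a = v := by
          have : a + (ℓ u - b) = ℓ v := by
            rw [← sub_sub_cancel (ℓ u) (ℓ v), h]
            abel
          simp [rotateEquiv, this]
        exact ⟨ℓ u - b, by simpa [hu, hv] using hadj.symm, by rw [hu, hv, Sym2.eq_swap]⟩

theorem countP'_map_univ {ι α : Type*} [Fintype ι] (p : α → Prop) (f : ι → α) :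
    countP' p ((Finset.univ : Finset ι).val.map f) = Nat.card {i // p (f i)} := by
  classical
  rw [countP', Multiset.countP_map, ← Finset.filter_val, Finset.card_val,
    Nat.card_eq_fintype_card, Fintype.card_subtype]

/-- if every tree of order 2n+1 is semigraceful, then
`K_{2n+1}^{(2·τ(2n+1))}` decomposes into 2n+1 copies of the family of all trees of
order 2n+1. -/
theorem decomposition_of_all_semigraceful (n : ℕ) (hn : 1 ≤ n)
    (hsg : ∀ T : SimpleGraph (Fin (2 * n + 1)), T.IsTree → IsSemigraceful n T) :
    ∃ M : Multiset (SimpleGraph (Fin (2 * n + 1))),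
      (∀ G ∈ M, G.IsTree) ∧
      (∀ T : SimpleGraph (Fin (2 * n + 1)), T.IsTree →
        countP' (fun G => Nonempty (G ≃g T)) M = 2 * n + 1) ∧
      (∀ a b : Fin (2 * n + 1), a ≠ b →
        countP' (fun G => G.Adj a b) M = 2 * tau (2 * n + 1)) := by
  classical
  choose ℓ hℓ using hsg
  let r := fun G H : { T : SimpleGraph (Fin (2 * n + 1)) // T.IsTree } => Nonempty (G.1 ≃g H.1)
  have hr : Equivalence r :=
    ⟨fun _ => ⟨.refl⟩, fun ⟨e⟩ => ⟨e.symm⟩, fun ⟨e⟩ ⟨e'⟩ => ⟨e.trans e'⟩⟩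
  let _ : Fintype (Quot r) := Fintype.ofFinite _
  let F : Quot r × Fin (2 * n + 1) → SimpleGraph (Fin (2 * n + 1)) := fun p =>
    p.1.out.1.comap (rotateEquiv (ℓ p.1.out.1 p.1.out.2) p.2)
  have iso : ∀ p, F p ≃g p.1.out.1 := fun p => SimpleGraph.Iso.comap _ _
  refine ⟨Finset.univ.val.map F, ?_, ?_, ?_⟩
  · intro G hG
    obtain ⟨p, -, rfl⟩ := Multiset.mem_map.1 hG
    exact (iso p).isTree_iff.2 p.1.out.2
  · intro T hT
    have key : ∀ p, Nonempty (F p ≃g T) ↔ p.1 = Quot.mk r ⟨T, hT⟩ := by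
      intro p
      have hp : p.1 = Quot.mk r p.1.out := (Quot.out_eq p.1).symm
      rw [hp.congr_left, hr.quot_mk_eq_iff]
      exact ⟨fun ⟨e⟩ => ⟨(iso p).symm.trans e⟩, fun ⟨e⟩ => ⟨(iso p).trans e⟩⟩
    rw [countP'_map_univ, Nat.card_eq_fintype_card, Fintype.card_subtype]
    have : (Finset.univ.filter fun p => Nonempty (F p ≃g T)) =
        {Quot.mk r ⟨T, hT⟩} ×ˢ Finset.univ := by
      ext p
      rw [Finset.mem_product]
      simp [key]
    rw [this, Finset.card_product]
    simp
  · intro a b hab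
    rw [countP'_map_univ, Nat.card_eq_fintype_card, Fintype.card_subtype, Finset.card_filter,
      Fintype.sum_prod_type]
    have (q : Quot r) : (∑ c, if (F (q, c)).Adj a b then 1 else 0) = 2 := by
      rw [← Finset.card_filter]
      exact card_rotations_adj (hℓ _ q.out.2) hab
    rw [Finset.sum_congr rfl fun q _ => this q, Finset.sum_const, Finset.card_univ,
      ← Nat.card_eq_fintype_card, smul_eq_mul, mul_comm]
    rfl
end

section
/- The complete multigraph K_5^{(6)} on 5 vertices with edge multiplicity 6 has a decomposition into 5 copies of the family of all trees of order 5: there exists a multiset M of spanning trees of the complete graph on 5 vertices such that every isomorphism class of trees on 5 vertices is represented by exactly 5 members of M (counted with multiplicity), and every pair of distinct vertices is an edge of exactly 6 members of M (counted with multiplicity). -/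
/-- The simple graph joining every `v` to `p v`. -/
def parentGraph {V : Type*} (p : V → V) : SimpleGraph V :=
  SimpleGraph.fromRel fun a b => p b = a

instance {V : Type*} [DecidableEq V] (p : V → V) : DecidableRel (parentGraph p).Adj :=
  inferInstanceAs (DecidableRel (SimpleGraph.fromRel fun a b => p b = a).Adj)

/-- If every nonzero vertex has a smaller parent, then the parent graph is connected. -/
theorem connected_parentGraph {n : ℕ} {p : Fin (n + 1) → Fin (n + 1)}
    (hp : ∀ i, i ≠ 0 → p i < i) : (parentGraph p).Connected := by
  have h : ∀ i, (parentGraph p).Reachable i 0 := by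
    intro i
    induction i using WellFoundedLT.induction with
    | ind i ih =>
      by_cases hi : i = 0
      · rw [hi]
      · refine SimpleGraph.Reachable.trans (SimpleGraph.Adj.reachable ?_) (ih (p i) (hp i hi))
        exact (SimpleGraph.fromRel_adj _ _ _).2 ⟨(hp i hi).ne', Or.inr rfl⟩
  exact (SimpleGraph.connected_iff_exists_forall_reachable _).2 ⟨0, fun i => (h i).symm⟩

/-- Removing leaves one at a time orders the vertices of a tree so that each vertex but the first
has exactly one neighbour before it. -/
theorem exists_parent_labeling (n : ℕ) {V : Type*} [Fintype V] (G : SimpleGraph V)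
    (hG : G.IsTree) (hV : Fintype.card V = n + 1) :
    ∃ (e : V → ℕ) (p : ℕ → ℕ), e.Injective ∧ (∀ x, e x ≤ n) ∧ p 0 = 0 ∧
      (∀ i, i ≠ 0 → p i < i) ∧
      ∀ a b, G.Adj a b ↔ a ≠ b ∧ (p (e b) = e a ∨ p (e a) = e b) := by
  classical
  induction n generalizing V with
  | zero =>
    have : Subsingleton V := Fintype.card_le_one_iff_subsingleton.1 hV.le
    refine ⟨fun _ => 0, fun _ => 0, fun _ _ _ => Subsingleton.elim _ _, fun _ => le_rfl, rfl,
      fun i hi => by lia, fun a b => ?_⟩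
    simp [Subsingleton.elim a b]
  | succ n ih =>
    have : Nontrivial V := Fintype.one_lt_card_iff_nontrivial.1 (by lia)
    obtain ⟨v, hv⟩ := hG.exists_vert_degree_one_of_nontrivial
    have hT : (G.induce {v}ᶜ).IsTree :=
      ⟨hG.connected.induce_compl_singleton_of_degree_eq_one hv, hG.isAcyclic.induce _⟩
    obtain ⟨u, hu, huniq⟩ := SimpleGraph.degree_eq_one_iff_existsUnique_adj.1 hv
    obtain ⟨e, p, he, hle, hp0, hp, hadj⟩ := ih (G.induce {v}ᶜ) hT (by
      rw [Fintype.card_compl_set]; simp [hV])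
    have huv : u ∈ ({v}ᶜ : Set V) := hu.ne'
    refine ⟨fun x => if h : x = v then n + 1 else e ⟨x, h⟩,
      fun i => if i = n + 1 then e ⟨u, huv⟩ else p i, ?_, ?_, ?_, ?_, ?_⟩
    · intro x y hxy
      by_cases hx : x = v <;> by_cases hy : y = v
      · rw [hx, hy]
      · have := hle ⟨y, hy⟩
        simp only [hx, hy, dite_true, dite_false] at hxy
        lia
      · have := hle ⟨x, hx⟩
        simp only [hx, hy, dite_true, dite_false] at hxy
        lia
      · simp only [hx, hy, dite_false] at hxy
        exact congrArg Subtype.val (he hxy)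
    · intro x
      by_cases hx : x = v
      · simp [hx]
      · have := hle ⟨x, hx⟩
        simp only [hx, dite_false]
        lia
    · simpa using hp0
    · intro i hi
      by_cases h : i = n + 1
      · have := hle ⟨u, huv⟩
        simp only [h, if_true]
        lia
      · simpa [h] using hp i hi
    · have hlt (x : V) (hx : x ≠ v) : p (e ⟨x, hx⟩) ≤ n := by
        have := hle ⟨x, hx⟩
        by_cases h : e ⟨x, hx⟩ = 0
        · simp [h, hp0]
        · have := hp _ h
          lia
      have hv' (x : V) (hx : x ≠ v) : G.Adj v x ↔ e ⟨u, huv⟩ = e ⟨x, hx⟩ :=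
        ⟨fun h => by congr 2; exact (huniq x h).symm,
          fun h => by rwa [← show u = x from congrArg Subtype.val (he h)]⟩
      intro a b
      by_cases ha : a = v <;> by_cases hb : b = v
      · simp [ha, hb]
      · have h1 := hlt b hb
        have h2 := hle ⟨b, hb⟩
        subst ha
        simp only [hb, dite_true, dite_false, if_true, hv' b hb]
        grind
      · have h1 := hlt a ha
        have h2 := hle ⟨a, ha⟩
        subst hb
        simp only [ha, dite_true, dite_false, if_true, G.adj_comm a, hv' a ha]
        grind
      · have h1 := hle ⟨a, ha⟩
        have h2 := hle ⟨b, hb⟩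
        have h3 := hadj ⟨a, ha⟩ ⟨b, hb⟩
        simp only [SimpleGraph.comap_adj, Function.Embedding.subtype_apply, ne_eq] at h3
        simp only [ha, hb, dite_false]
        grind

/-- Every tree of order `n + 1` is the parent graph of a map decreasing away from `0`. -/
theorem exists_iso_parentGraph {n : ℕ} (G : SimpleGraph (Fin (n + 1))) (hG : G.IsTree) :
    ∃ p : Fin (n + 1) → Fin (n + 1), p 0 = 0 ∧ (∀ i, i ≠ 0 → p i < i) ∧
      Nonempty (G ≃g parentGraph p) := by
  obtain ⟨e, p, he, hle, hp0, hp, hadj⟩ := exists_parent_labeling n G hG (by simp)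
  have hpn (i : Fin (n + 1)) : p i < n + 1 := by
    by_cases h : (i : ℕ) = 0
    · simp [h, hp0]
    · exact (hp i h).trans i.2
  let f : Fin (n + 1) ≃ Fin (n + 1) := Equiv.ofBijective
    (fun x => ⟨e x, Nat.lt_succ_of_le (hle x)⟩)
    (Finite.injective_iff_bijective.1 fun x y h => he (congrArg Fin.val h))
  refine ⟨fun i => ⟨p i, hpn i⟩, Fin.ext hp0, fun i hi => hp i fun h => hi (Fin.ext h),
    ⟨f, ?_⟩⟩
  intro a b
  rw [parentGraph, SimpleGraph.fromRel_adj, hadj, f.injective.ne_iff]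
  simp [f, Fin.ext_iff]

/-- The star, the path and the fork of order five, each with two edges of either cyclic
distance. -/
def parentMaps : Multiset (Fin 5 → Fin 5) :=
  {![0, 0, 0, 0, 0], ![0, 0, 0, 1, 3], ![0, 0, 0, 1, 0]}

theorem isTree_of_mem_parentMaps {p : Fin 5 → Fin 5} (hp : p ∈ parentMaps) :
    (parentGraph p).IsTree := by
  rw [SimpleGraph.isTree_iff_connected_and_card, Nat.card_eq_fintype_card,
    ← SimpleGraph.edgeFinset_card]
  simp only [parentMaps, Multiset.insert_eq_cons, Multiset.mem_cons, Multiset.mem_singleton] at hp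
  rcases hp with rfl | rfl | rfl <;>
    exact ⟨connected_parentGraph (by decide), by simp; decide +kernel⟩

theorem exists_perm_parentMaps : ∀ b c d : Fin 5, b < 2 → c < 3 → d < 4 →
    ∃ p ∈ parentMaps, ∃ f : Equiv.Perm (Fin 5), ∀ x y,
      (parentGraph p).Adj (f x) (f y) ↔ (parentGraph ![0, 0, b, c, d]).Adj x y := by
  decide +kernel

theorem exists_iso_of_isTree (T : SimpleGraph (Fin 5)) (hT : T.IsTree) :
    ∃ p ∈ parentMaps, Nonempty (T ≃g parentGraph p) := by
  obtain ⟨q, hq0, hq, ⟨g⟩⟩ := exists_iso_parentGraph T hT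
  have hq1 : q 1 = 0 := by have := hq 1 (by decide); lia
  obtain ⟨p, hp, f, hf⟩ := exists_perm_parentMaps (q 2) (q 3) (q 4) (hq 2 (by decide))
    (hq 3 (by decide)) (hq 4 (by decide))
  have : q = ![0, 0, q 2, q 3, q 4] := by
    ext i
    fin_cases i <;> simp [hq0, hq1]
  rw [← this] at hf
  exact ⟨p, hp, ⟨g.trans ⟨f, hf _ _⟩⟩⟩

theorem eq_of_maxDegree_eq : ∀ p ∈ parentMaps, ∀ q ∈ parentMaps,
    (parentGraph p).maxDegree = (parentGraph q).maxDegree → p = q := by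
  decide +kernel

/-- All cyclic rotations of the three trees. -/
def rotatedTrees : Multiset (SimpleGraph (Fin 5)) :=
  (parentMaps ×ˢ (Finset.univ : Finset (Fin 5)).val).map fun x =>
    (parentGraph x.1).comap (Equiv.addRight x.2)

theorem countP'_rotatedTrees {P : SimpleGraph (Fin 5) → Prop}
    {Q : (Fin 5 → Fin 5) × Fin 5 → Prop} [DecidablePred Q]
    (h : ∀ x : (Fin 5 → Fin 5) × Fin 5, x.1 ∈ parentMaps →
      (P ((parentGraph x.1).comap (Equiv.addRight x.2)) ↔ Q x)) :
    countP' P rotatedTrees =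
      ((parentMaps ×ˢ (Finset.univ : Finset (Fin 5)).val).filter Q).card := by
  let _ := Classical.decPred P
  refine (Multiset.countP_map _ _ P).trans ?_
  congr 1
  convert Multiset.filter_congr fun x hx => h x (Multiset.mem_product.1 hx).1

theorem card_adj_rotatedTrees : ∀ a b : Fin 5, a ≠ b →
    ((parentMaps ×ˢ (Finset.univ : Finset (Fin 5)).val).filter fun x =>
      (parentGraph x.1).Adj (a + x.2) (b + x.2)).card = 6 := by
  decide +kernel

/-- `K_5^{(6)}` decomposes into 5 copies of the family of all trees of
order 5. -/
theorem K5_6_decomposes_into_five_copies_of_trees_of_order_five :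
    ∃ M : Multiset (SimpleGraph (Fin 5)),
      (∀ G ∈ M, G.IsTree) ∧
      (∀ T : SimpleGraph (Fin 5), T.IsTree →
        countP' (fun G => Nonempty (G ≃g T)) M = 5) ∧
      (∀ a b : Fin 5, a ≠ b → countP' (fun G => G.Adj a b) M = 6) := by
  refine ⟨rotatedTrees, ?_, ?_, ?_⟩
  · intro G hG
    obtain ⟨⟨p, k⟩, h, rfl⟩ := Multiset.mem_map.1 hG
    exact (SimpleGraph.Iso.comap (Equiv.addRight k) (parentGraph p)).isTree_iff.2
      (isTree_of_mem_parentMaps (Multiset.mem_product.1 h).1)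
  · intro T hT
    obtain ⟨q, hq, ⟨g⟩⟩ := exists_iso_of_isTree T hT
    have hcount : ∀ q ∈ parentMaps,
        ((parentMaps ×ˢ (Finset.univ : Finset (Fin 5)).val).filter fun x =>
          x.1 = q).card = 5 := by decide +kernel
    refine (countP'_rotatedTrees fun x hx => ?_).trans (hcount q hq)
    refine ⟨fun ⟨h⟩ => ?_, fun h => ?_⟩
    · refine eq_of_maxDegree_eq _ hx _ hq ?_
      exact SimpleGraph.Iso.maxDegree_eq
        (((SimpleGraph.Iso.comap (Equiv.addRight x.2) (parentGraph x.1)).symm.trans h).trans g)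
    · subst h
      exact ⟨(SimpleGraph.Iso.comap (Equiv.addRight x.2) (parentGraph x.1)).trans g.symm⟩
  · intro a b hab
    exact (countP'_rotatedTrees fun _ _ => Iff.rfl).trans (card_adj_rotatedTrees a b hab)
end
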